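/- Let Ω ⊂ ℝ² be a bounded open connected set with (0,0) ∈ Ω, and let u be a smooth function on an open set containing the closure of Ω such that: -Δu = f(u) in Ω with f smooth and f(0) ≥ 0; u > 0 in Ω and u = 0 on ∂Ω; at every boundary point p ∈ ∂Ω one has (u_xx u_y² - 2 u_xy u_x u_y + u_yy u_x²)(p) < 0 (which expresses that the boundary — a level curve of u — has strictly positive curvature and that ∇u ≠ 0 there); and (0,0) is the only critical point of u in Ω. Then (0,0) is a nondegenerate critical point of u, i.e. the Hessian matrix of u at (0,0) is invertible. -/

import Mathlib

open Filter Metric Set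

/-- Partial derivative in the first variable. -/
noncomputable def pdx (u : ℝ → ℝ → ℝ) : ℝ → ℝ → ℝ := fun x y => deriv (fun t => u t y) x

/-- Partial derivative in the second variable. -/
noncomputable def pdy (u : ℝ → ℝ → ℝ) : ℝ → ℝ → ℝ := fun x y => deriv (fun t => u x t) y

/-- `pd u i j = ∂^(i+j) u / ∂x^i ∂y^j`. -/
noncomputable def pd (u : ℝ → ℝ → ℝ) (i j : ℕ) : ℝ → ℝ → ℝ := pdx^[i] (pdy^[j] u)

/-- The open unit ball of `ℝ²`. -/
def B1 : Set (ℝ × ℝ) := Metric.ball (0 : ℝ × ℝ) 1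

/-- Real part of `(x+iy)^n`. -/
noncomputable def ReZ (n : ℕ) (x y : ℝ) : ℝ := (((x : ℂ) + (y : ℂ) * Complex.I) ^ n).re

/-- Imaginary part of `(x+iy)^n`. -/
noncomputable def ImZ (n : ℕ) (x y : ℝ) : ℝ := (((x : ℂ) + (y : ℂ) * Complex.I) ^ n).im

/-- The numerator `u_xx u_y² - 2 u_xy u_x u_y + u_yy u_x²` whose negativity expresses
strictly positive curvature of the level curve of `u`. -/
noncomputable def curvNum (u : ℝ → ℝ → ℝ) (x y : ℝ) : ℝ :=
  pd u 2 0 x y * (pd u 0 1 x y) ^ 2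
    - 2 * pd u 1 1 x y * pd u 1 0 x y * pd u 0 1 x y
    + pd u 0 2 x y * (pd u 1 0 x y) ^ 2

open Topology in
lemma slice_test (φ φ' : ℝ → ℝ) (t c : ℝ) (h : ∀ᶠ s in 𝓝 t, HasDerivAt φ (φ' s) s)
    (h2 : HasDerivAt φ' c t) (hmin : IsLocalMin φ t) : φ' t = 0 ∧ 0 ≤ c := by
  have h1 : φ' t = 0 := hmin.hasDerivAt_eq_zero h.self_of_nhds
  refine ⟨h1, ?_⟩
  by_contra hc
  push Not at hc
  have e1 : deriv φ =ᶠ[𝓝 t] φ' := h.mono fun s hs => hs.deriv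
  have e2 : deriv (deriv φ) t = c := by rw [e1.deriv_eq]; exact h2.deriv
  have hmax : IsLocalMax φ t := by
    apply isLocalMax_of_deriv_deriv_neg (by rw [e2]; exact hc)
    · rw [e1.self_of_nhds, h1]
    · exact h.self_of_nhds.continuousAt
  have hconst : φ =ᶠ[𝓝 t] fun _ => φ t := by
    filter_upwards [hmin, hmax] with s a b using le_antisymm b a
  have e3 : deriv φ =ᶠ[𝓝 t] fun _ => 0 := by
    have := hconst.deriv
    simpa using this
  have : deriv (deriv φ) t = 0 := by rw [e3.deriv_eq]; simp
  linarith

lemma exists_eps {X : Type*} [TopologicalSpace X] (S : Set X) (hS : IsCompact S) (Q h : X → ℝ)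
    (hQ : ContinuousOn Q S) (hh : ContinuousOn h S) (hpos : ∀ z ∈ S, 0 < Q z) :
    ∃ ε > 0, ∀ z ∈ S, ε * h z < Q z := by
  rcases S.eq_empty_or_nonempty with rfl | hne
  · exact ⟨1, one_pos, by simp⟩
  obtain ⟨z0, hz0, hm⟩ := hS.exists_isMinOn hne hQ
  obtain ⟨z1, hz1, hM⟩ := hS.exists_isMaxOn hne hh
  have hη := hpos z0 hz0
  have hH : 0 < |h z1| + 1 := by positivity
  refine ⟨Q z0 / (2 * (|h z1| + 1)), by positivity, fun z hz => ?_⟩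
  have a : Q z0 ≤ Q z := hm hz
  have b : h z ≤ h z1 := hM hz
  have c : h z ≤ |h z1| + 1 := by linarith [le_abs_self (h z1)]
  calc Q z0 / (2 * (|h z1| + 1)) * h z ≤ Q z0 / (2 * (|h z1| + 1)) * (|h z1| + 1) := by gcongr
    _ = Q z0 / 2 := by field_simp
    _ < Q z := by linarith

/-- directional derivative -/
noncomputable def dir (v : ℝ × ℝ) (g : ℝ × ℝ → ℝ) (p : ℝ × ℝ) : ℝ := fderiv ℝ g p v

section
variable {V : Set (ℝ × ℝ)} {g : ℝ × ℝ → ℝ}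

lemma dir_smooth (hV : IsOpen V) (hg : ContDiffOn ℝ (⊤ : ℕ∞) g V) (v : ℝ × ℝ) :
    ContDiffOn ℝ (⊤ : ℕ∞) (dir v g) V := by
  have : ContDiffOn ℝ (⊤ : ℕ∞) (fderiv ℝ g) V := hg.fderiv_of_isOpen hV (by simp)
  exact this.clm_apply contDiffOn_const

lemma smooth_diff (hV : IsOpen V) (hg : ContDiffOn ℝ (⊤ : ℕ∞) g V) {p : ℝ × ℝ} (hp : p ∈ V) :
    DifferentiableAt ℝ g p :=
  (hg.contDiffAt (hV.mem_nhds hp)).differentiableAt (by simp)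

lemma dir_curve {p v : ℝ × ℝ} {t : ℝ} {c : ℝ → ℝ × ℝ} (hg : DifferentiableAt ℝ g p)
    (hc : HasDerivAt c v t) (hp : c t = p) : HasDerivAt (fun s => g (c s)) (dir v g p) t := by
  subst hp
  exact hg.hasFDerivAt.comp_hasDerivAt t hc

lemma dir_comm (hV : IsOpen V) (hg : ContDiffOn ℝ (⊤ : ℕ∞) g V) {p : ℝ × ℝ} (hp : p ∈ V)
    (v w : ℝ × ℝ) : dir v (dir w g) p = dir w (dir v g) p := by
  have hga := hg.contDiffAt (hV.mem_nhds hp)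
  have hs : IsSymmSndFDerivAt ℝ g p := hga.isSymmSndFDerivAt (by simp; exact WithTop.coe_le_coe.2 (le_top : (2 : ℕ∞) ≤ ⊤))
  have hd : DifferentiableAt ℝ (fderiv ℝ g) p :=
    ((hg.fderiv_of_isOpen hV (m := (⊤ : ℕ∞)) (by simp)).contDiffAt (hV.mem_nhds hp)).differentiableAt (by simp)
  have key : ∀ v w, dir v (dir w g) p = fderiv ℝ (fderiv ℝ g) p v w := by
    intro v w
    unfold dir
    rw [fderiv_clm_apply hd (by fun_prop)]
    simp
  rw [key, key, hs.eq]

lemma dir_lin (v : ℝ × ℝ) (p : ℝ × ℝ) : dir v g p = v.1 * dir (1, 0) g p + v.2 * dir (0, 1) g p := by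
  unfold dir
  have : v = v.1 • ((1, 0) : ℝ × ℝ) + v.2 • ((0, 1) : ℝ × ℝ) := by ext <;> simp
  conv_lhs => rw [this]
  rw [map_add, map_smul, map_smul]; simp

lemma dir_congr {g' : ℝ × ℝ → ℝ} (hV : IsOpen V) (h : ∀ q ∈ V, g q = g' q) {p : ℝ × ℝ} (hp : p ∈ V)
    (v : ℝ × ℝ) : dir v g p = dir v g' p := by
  unfold dir
  rw [Filter.EventuallyEq.fderiv_eq]
  filter_upwards [hV.mem_nhds hp] with q hq using h q hq

/-- second directional derivative through the coordinate ones -/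
lemma dir_lin2 (hV : IsOpen V) (hg : ContDiffOn ℝ (⊤ : ℕ∞) g V) {p : ℝ × ℝ} (hp : p ∈ V)
    (v w : ℝ × ℝ) : dir v (dir w g) p = v.1 * w.1 * dir (1, 0) (dir (1, 0) g) p
      + (v.1 * w.2 + v.2 * w.1) * dir (1, 0) (dir (0, 1) g) p
      + v.2 * w.2 * dir (0, 1) (dir (0, 1) g) p := by
  rw [dir_lin v, dir_comm hV hg hp (1, 0) w, dir_comm hV hg hp (0, 1) w, dir_lin w, dir_lin w,
    dir_comm hV hg hp (0, 1) (1, 0)]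
  ring
end

open Topology

lemma poly_pos (t p a b q g : ℝ) (ht : t ^ 2 ≤ 2) (hp : |p| ≤ 1 / 50) (ha : |a| ≤ 1 / 50)
    (hb : |b| ≤ 1 / 50) (hq : |q| ≤ 1 / 50) (hg : |g| ≤ 1 / 50) :
    0 < (p ^ 2 + (1 + q) ^ 2) * (31 / 4 - 3 / 8 * t ^ 2) + 2 * t * (p * a - (1 + q) * b)
      - 2 * (p * b + (1 + q) * (1 + g)) * (7 / 2 - 3 / 4 * t ^ 2) := by
  have hq' := abs_le.1 hq
  have hg' := abs_le.1 hg
  have ht' : |t| ≤ 3 / 2 := abs_le_of_sq_le_sq (by linarith) (by norm_num) |> fun h => h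
  have t2 : 0 ≤ t ^ 2 := sq_nonneg t
  have h1 : |p * a| ≤ 1 / 2500 := by
    rw [abs_mul]; nlinarith [abs_nonneg p, abs_nonneg a]
  have h2 : |p * b| ≤ 1 / 2500 := by
    rw [abs_mul]; nlinarith [abs_nonneg p, abs_nonneg b]
  have hq1 : |1 + q| ≤ 51 / 50 := by rw [abs_le]; constructor <;> linarith
  have h3 : |(1 + q) * b| ≤ 51 / 2500 := by
    rw [abs_mul]; nlinarith [abs_nonneg (1 + q), abs_nonneg b]
  have h4 : |p * a - (1 + q) * b| ≤ 52 / 2500 := by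
    have := abs_sub (p * a) ((1 + q) * b); linarith
  have h5 : |t * (p * a - (1 + q) * b)| ≤ 3 / 2 * (52 / 2500) := by
    rw [abs_mul]; gcongr
  have h5' := (abs_le.1 h5).1
  have h2' := abs_le.1 h2
  have h6 : p * b * (7 / 2 - 3 / 4 * t ^ 2) ≤ 1 / 2500 * (7 / 2) := by nlinarith
  have h7 : 0 ≤ p ^ 2 * (31 / 4 - 3 / 8 * t ^ 2) := by
    apply mul_nonneg (sq_nonneg _); linarith
  have h8 : (9 : ℝ) / 20 ≤ (1 + q) * (31 / 4 - 3 / 8 * t ^ 2) - 2 * (1 + g) * (7 / 2 - 3 / 4 * t ^ 2) := by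
    nlinarith
  have h9 : (49 : ℝ) / 50 * (9 / 20) ≤ (1 + q) * ((1 + q) * (31 / 4 - 3 / 8 * t ^ 2) - 2 * (1 + g) * (7 / 2 - 3 / 4 * t ^ 2)) := by
    apply mul_le_mul <;> linarith
  nlinarith

lemma barrier_alg (l x y w v α β γ Y : ℝ) (hl : l ≠ 0) (hy : 0 < y) (hY : 0 < Y) (hx : x ^ 2 ≤ 2 * y ^ 2)
    (hw : |w| ≤ |l| / 50 * y) (hv : |v + l * y| ≤ |l| / 50 * y) (hα : |α| ≤ |l| / 50)
    (hβ : |β| ≤ |l| / 50) (hγ : |γ + l| ≤ |l| / 50) :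
    2 * (w * α + v * β) * (-(x * Y)) + 2 * (w * β + v * γ) * (7 / 2 * (y * Y) - 3 / 4 * x ^ 2 * (Y / y))
      < (w ^ 2 + v ^ 2) * (- Y + (35 / 4 * Y - 3 / 8 * x ^ 2 * (Y / y ^ 2))) := by
  have hl' : 0 < |l| := abs_pos.2 hl
  have key := poly_pos (x / y) (w / (l * y)) (α / l) (β / l) (-(v + l * y) / (l * y)) (-(γ + l) / l)
    (by rw [div_pow, div_le_iff₀ (by positivity)]; exact hx)
    (by rw [abs_div, abs_mul, abs_of_pos hy, div_le_iff₀ (by positivity)]; linarith)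
    (by rw [abs_div, div_le_iff₀ (by positivity)]; linarith)
    (by rw [abs_div, div_le_iff₀ (by positivity)]; linarith)
    (by rw [abs_div, abs_neg, abs_mul, abs_of_pos hy, div_le_iff₀ (by positivity)]; linarith)
    (by rw [abs_div, abs_neg, div_le_iff₀ (by positivity)]; linarith)
  have h2 : 0 < l ^ 2 * y ^ 2 * Y := by positivity
  have := mul_pos h2 key
  rw [← sub_pos]
  refine this.trans_eq ?_
  field_simp
  ring

lemma mv_chain {ρ C : ℝ} {k : ℕ} {g g' : ℝ → ℝ} (hC : 0 ≤ C)
    (hd : ∀ t, |t| < ρ → HasDerivAt g (g' t) t) (hb : ∀ t, |t| < ρ → |g' t| ≤ C * |t| ^ k)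
    (h0 : g 0 = 0) (t : ℝ) (ht : |t| < ρ) : |g t| ≤ C * |t| ^ (k + 1) := by
  have hs : ∀ s ∈ uIcc 0 t, |s| ≤ |t| := by
    intro s hs
    have := abs_sub_left_of_mem_uIcc hs
    simpa using this
  have := (convex_uIcc (0:ℝ) t).norm_image_sub_le_of_norm_hasDerivWithin_le (f := g) (f' := g')
    (C := C * |t| ^ k) (x := 0) (y := t)
    (fun s h => (hd s ((hs s h).trans_lt ht)).hasDerivWithinAt)
    (fun s h => by
      rw [Real.norm_eq_abs]
      refine (hb s ((hs s h).trans_lt ht)).trans ?_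
      have := hs s h
      gcongr) left_mem_uIcc right_mem_uIcc
  simp only [h0, sub_zero, Real.norm_eq_abs] at this
  rw [pow_succ, ← mul_assoc]; exact this

lemma oneD {ρ C ε : ℝ} {q0 q1 q2 q3 q4 : ℝ → ℝ} (hρ : 0 < ρ) (hC : 0 ≤ C) (hε : 0 < ε)
    (h0 : ∀ t, |t| < ρ → HasDerivAt q0 (q1 t) t)
    (h1 : ∀ t, |t| < ρ → HasDerivAt q1 (q2 t) t)
    (h2 : ∀ t, |t| < ρ → HasDerivAt q2 (q3 t) t)
    (h3 : ∀ t, |t| < ρ → HasDerivAt q3 (q4 t) t)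
    (hb : ∀ t, |t| < ρ → |q4 t| ≤ C)
    (z0 : q0 0 = 0) (z1 : q1 0 = 0) (z2 : q2 0 = 0)
    (hpos : ∀ t, |t| < ρ → 0 ≤ q0 t)
    (hlow : ∀ t, 0 < t → t < ρ → ε * t ^ (7 / 2 : ℝ) ≤ q0 t) : False := by
  set c := q3 0 with hc
  have b3 : ∀ t, |t| < ρ → |q3 t - c| ≤ C * |t| ^ 1 :=
    mv_chain (k := 0) (g' := q4) hC (fun t ht => (h3 t ht).sub_const c) (by simpa using hb) (by simp [hc])
  have b2 : ∀ t, |t| < ρ → |q2 t - c * t| ≤ C * |t| ^ 2 :=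
    mv_chain (k := 1) (g' := fun t => q3 t - c) hC
      (fun t ht => ((h2 t ht).sub ((hasDerivAt_id t).const_mul c)).congr_deriv (by simp)) b3 (by simp [z2])
  have b1 : ∀ t, |t| < ρ → |q1 t - c * t ^ 2 / 2| ≤ C * |t| ^ 3 :=
    mv_chain (k := 2) (g' := fun t => q2 t - c * t) hC
      (fun t ht => by
        have := (h1 t ht).sub (((hasDerivAt_pow 2 t).const_mul c).div_const 2)
        exact this.congr_deriv (by simp; ring)) b2 (by simp [z1])
  have b0 : ∀ t, |t| < ρ → |q0 t - c * t ^ 3 / 6| ≤ C * |t| ^ 4 :=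
    mv_chain (k := 3) (g' := fun t => q1 t - c * t ^ 2 / 2) hC
      (fun t ht => by
        have := (h0 t ht).sub (((hasDerivAt_pow 3 t).const_mul c).div_const 6)
        exact this.congr_deriv (by simp; ring)) b1 (by simp [z0])
  have hIoo : Ioo (0:ℝ) ρ ∈ 𝓝[>] (0:ℝ) := Ioo_mem_nhdsGT hρ
  have cle : c ≤ 0 := by
    have : ∀ᶠ t in 𝓝[>] (0:ℝ), c / 6 ≤ C * t := by
      filter_upwards [hIoo] with t ht
      have ha : |-t| < ρ := by rw [abs_neg, abs_of_pos ht.1]; exact ht.2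
      have A := hpos _ ha
      have B := (abs_le.1 (b0 _ ha)).2
      rw [abs_neg, abs_of_pos ht.1] at B
      have : c / 6 * t ^ 3 ≤ C * t * t ^ 3 := by nlinarith
      exact le_of_mul_le_mul_right this (pow_pos ht.1 3)
    have lim : Tendsto (fun t : ℝ => C * t) (𝓝[>] 0) (𝓝 (C * 0)) :=
      ((continuous_const.mul continuous_id).tendsto 0).mono_left nhdsWithin_le_nhds
    have := ge_of_tendsto lim this
    linarith
  have : ∀ᶠ t in 𝓝[>] (0:ℝ), ε ≤ C * t ^ (1 / 2 : ℝ) := by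
    filter_upwards [hIoo] with t ht
    have ha : |t| < ρ := by rw [abs_of_pos ht.1]; exact ht.2
    have A := hlow t ht.1 ht.2
    have B := (abs_le.1 (b0 _ ha)).2
    rw [abs_of_pos ht.1] at B
    have p3 := pow_pos ht.1 3
    have e1 : C * t ^ 4 = C * t ^ (1 / 2 : ℝ) * t ^ (7 / 2 : ℝ) := by
      rw [mul_assoc, ← Real.rpow_add ht.1, ← Real.rpow_natCast]; norm_num
    have : ε * t ^ (7 / 2 : ℝ) ≤ C * t ^ (1 / 2 : ℝ) * t ^ (7 / 2 : ℝ) := by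
      rw [← e1]; nlinarith
    exact le_of_mul_le_mul_right this (Real.rpow_pos_of_pos ht.1 _)
  have lim : Tendsto (fun t : ℝ => C * t ^ (1 / 2 : ℝ)) (𝓝[>] 0) (𝓝 (C * 0 ^ (1 / 2 : ℝ))) :=
    ((continuous_const.mul (Real.continuous_rpow_const (by norm_num))).tendsto 0).mono_left nhdsWithin_le_nhds
  have := ge_of_tendsto lim this
  rw [Real.zero_rpow (by norm_num)] at this
  linarith

lemma barrier (O : Set (ℝ × ℝ)) (hO : IsOpen O) (h0O : ((0, 0) : ℝ × ℝ) ∈ O) (l : ℝ) (hl : l ≠ 0)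
    (Q Qx Qy Qxx Qyy w v α β γ : ℝ × ℝ → ℝ) (hQc : ContinuousOn Q O)
    (hx : ∀ z ∈ O, HasDerivAt (fun s => Q (s, z.2)) (Qx z) z.1)
    (hxx : ∀ z ∈ O, HasDerivAt (fun s => Qx (s, z.2)) (Qxx z) z.1)
    (hy : ∀ z ∈ O, HasDerivAt (fun s => Q (z.1, s)) (Qy z) z.2)
    (hyy : ∀ z ∈ O, HasDerivAt (fun s => Qy (z.1, s)) (Qyy z) z.2)
    (heq : ∀ z ∈ O, (w z ^ 2 + v z ^ 2) * (Qxx z + Qyy z) =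
      2 * (w z * α z + v z * β z) * Qx z + 2 * (w z * β z + v z * γ z) * Qy z)
    (hQ0 : ∀ z ∈ O, 0 ≤ Q z) (hQpos : ∀ z ∈ O, z ≠ (0, 0) → 0 < Q z)
    (hw : w =o[𝓝 (0, 0)] (fun z => z)) (hv : (fun z => v z + l * z.2) =o[𝓝 (0, 0)] (fun z => z))
    (hα : Tendsto α (𝓝 (0, 0)) (𝓝 0)) (hβ : Tendsto β (𝓝 (0, 0)) (𝓝 0))
    (hγ : Tendsto γ (𝓝 (0, 0)) (𝓝 (-l))) :
    ∃ ε > 0, ∃ ρ > 0, ∀ y, 0 < y → y < ρ → ε * y ^ (7 / 2 : ℝ) ≤ Q (0, y) := by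
  have hl' : 0 < |l| := abs_pos.2 hl
  have hd : 0 < |l| / 100 := by positivity
  have hev : ∀ᶠ z in 𝓝 ((0, 0) : ℝ × ℝ), z ∈ O ∧ |w z| ≤ |l| / 100 * ‖z‖ ∧
      |v z + l * z.2| ≤ |l| / 100 * ‖z‖ ∧ |α z| < |l| / 100 ∧ |β z| < |l| / 100 ∧
      |γ z + l| < |l| / 100 := by
    filter_upwards [hO.mem_nhds h0O, hw.bound hd, hv.bound hd, Metric.tendsto_nhds.1 hα _ hd,
      Metric.tendsto_nhds.1 hβ _ hd, Metric.tendsto_nhds.1 hγ _ hd] with z a b c d e f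
    simp only [Real.norm_eq_abs, Real.dist_eq, sub_zero, sub_neg_eq_add] at b c d e f
    exact ⟨a, b, c, d, e, f⟩
  obtain ⟨ρ0, hρ0, hball⟩ := Metric.eventually_nhds_iff.1 hev
  set ρ := ρ0 / 4 with hρ
  have hρpos : 0 < ρ := by positivity
  have hxb : ∀ x y : ℝ, 0 ≤ y → x ^ 2 ≤ 2 * y ^ 2 → |x| ≤ 2 * y := fun x y hy h =>
    abs_le_of_sq_le_sq (by nlinarith) (by positivity)
  have hnorm : ∀ x y : ℝ, 0 ≤ y → x ^ 2 ≤ 2 * y ^ 2 → ‖(x, y)‖ ≤ 2 * y := by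
    intro x y hy h
    rw [Prod.norm_mk, Real.norm_eq_abs, Real.norm_eq_abs, abs_of_nonneg hy]
    exact max_le (hxb x y hy h) (by linarith)
  have hgood : ∀ x y : ℝ, 0 ≤ y → y ≤ ρ → x ^ 2 ≤ 2 * y ^ 2 → (x, y) ∈ O ∧ |w (x, y)| ≤ |l| / 50 * y ∧
      |v (x, y) + l * y| ≤ |l| / 50 * y ∧ |α (x, y)| ≤ |l| / 50 ∧ |β (x, y)| ≤ |l| / 50 ∧
      |γ (x, y) + l| ≤ |l| / 50 := by
    intro x y h1 h2 h3
    have hn := hnorm x y h1 h3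
    have hmul : |l| / 100 * ‖(x, y)‖ ≤ |l| / 50 * y := by nlinarith
    obtain ⟨a, b, c, d, e, f⟩ := hball (y := (x, y)) (by
      rw [show ((0, 0) : ℝ × ℝ) = 0 from rfl, dist_zero_right]; linarith)
    exact ⟨a, b.trans hmul, c.trans hmul, by linarith, by linarith, by linarith⟩
  let b : ℝ × ℝ → ℝ := fun z => z.2 ^ (7 / 2 : ℝ) - z.1 ^ 2 / 2 * z.2 ^ (3 / 2 : ℝ)
  have hbc : Continuous b := by
    have r1 : Continuous fun z : ℝ × ℝ => z.2 ^ (7 / 2 : ℝ) :=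
      (Real.continuous_rpow_const (by norm_num)).comp continuous_snd
    have r2 : Continuous fun z : ℝ × ℝ => z.2 ^ (3 / 2 : ℝ) :=
      (Real.continuous_rpow_const (by norm_num)).comp continuous_snd
    exact r1.sub (((continuous_fst.pow 2).div_const 2).mul r2)
  let K : Set (ℝ × ℝ) := {z | 0 ≤ z.2 ∧ z.2 ≤ ρ ∧ z.1 ^ 2 ≤ 2 * z.2 ^ 2}
  have hKclosed : IsClosed K := by
    apply (isClosed_le continuous_const continuous_snd).inter
    apply (isClosed_le continuous_snd continuous_const).inter
    exact isClosed_le (continuous_fst.pow 2) (continuous_const.mul (continuous_snd.pow 2))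
  have hKc : IsCompact K := by
    apply Metric.isCompact_of_isClosed_isBounded hKclosed
    apply (Metric.isBounded_closedBall (x := (0 : ℝ × ℝ)) (r := 2 * ρ)).subset
    rintro ⟨x, y⟩ ⟨h1, h2, h3⟩
    rw [mem_closedBall, dist_zero_right]
    have := hnorm x y h1 h3
    simp only at h2
    linarith
  have hKO : K ⊆ O := fun z hz => (hgood z.1 z.2 hz.1 hz.2.1 hz.2.2).1
  let S : Set (ℝ × ℝ) := K ∩ {z | z.2 = ρ}
  have hSc : IsCompact S := hKc.inter_right (isClosed_eq continuous_snd continuous_const)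
  obtain ⟨ε, hε, hεS⟩ := exists_eps S hSc Q b (hQc.mono (inter_subset_left.trans hKO)) hbc.continuousOn
    (fun z hz => hQpos z (hKO hz.1) (by
      rintro rfl
      exact hρpos.ne hz.2))
  have hKne : K.Nonempty := ⟨(0, 0), by simp [K, hρpos.le]⟩
  obtain ⟨z0, hz0, hmin⟩ := hKc.exists_isMinOn (f := fun z => Q z - ε * b z) hKne
    ((hQc.mono hKO).sub (hbc.const_mul ε).continuousOn)
  have hnonneg : 0 ≤ Q z0 - ε * b z0 := by
    by_contra hneg
    push Not at hneg
    obtain ⟨x0, y0⟩ := z0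
    have hQz := hQ0 _ (hKO hz0)
    obtain ⟨h1, h2, h3⟩ := hz0
    simp only at h1 h2 h3
    have hbpos : 0 < b (x0, y0) := by
      by_contra hb
      push Not at hb
      nlinarith
    have hy0 : 0 < y0 := by
      rcases h1.lt_or_eq with h | h
      · exact h
      · exfalso
        subst h
        simp only [b] at hbpos
        rw [Real.zero_rpow (by norm_num), Real.zero_rpow (by norm_num)] at hbpos
        simp at hbpos
    have hY : 0 < y0 ^ (3 / 2 : ℝ) := Real.rpow_pos_of_pos hy0 _
    have e72 : y0 ^ (7 / 2 : ℝ) = y0 ^ 2 * y0 ^ (3 / 2 : ℝ) := by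
      rw [← Real.rpow_natCast y0 2, ← Real.rpow_add hy0]; norm_num
    have e52 : y0 ^ (5 / 2 : ℝ) = y0 * y0 ^ (3 / 2 : ℝ) := by
      rw [show (5 / 2 : ℝ) = 1 + 3 / 2 by norm_num, Real.rpow_add hy0, Real.rpow_one]
    have e12 : y0 ^ (1 / 2 : ℝ) = y0 ^ (3 / 2 : ℝ) / y0 := by
      rw [show (1 / 2 : ℝ) = 3 / 2 - 1 by norm_num, Real.rpow_sub hy0, Real.rpow_one]
    have em12 : y0 ^ (-1 / 2 : ℝ) = y0 ^ (3 / 2 : ℝ) / y0 ^ 2 := by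
      rw [show (-1 / 2 : ℝ) = 3 / 2 - (2 : ℕ) by norm_num, Real.rpow_sub hy0, Real.rpow_natCast]
    have hx0 : x0 ^ 2 < 2 * y0 ^ 2 := by
      by_contra hb
      push Not at hb
      simp only [b] at hbpos
      rw [e72] at hbpos
      nlinarith
    have hy1 : y0 < ρ := by
      rcases h2.lt_or_eq with h | h
      · exact h
      · exfalso
        have := hεS (x0, y0) ⟨⟨h1, h2, h3⟩, h⟩
        linarith
    have hKn : K ∈ 𝓝 (x0, y0) := by
      have o : IsOpen {z : ℝ × ℝ | 0 < z.2 ∧ z.2 < ρ ∧ z.1 ^ 2 < 2 * z.2 ^ 2} := by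
        apply (isOpen_lt continuous_const continuous_snd).inter
        apply (isOpen_lt continuous_snd continuous_const).inter
        exact isOpen_lt (continuous_fst.pow 2) (continuous_const.mul (continuous_snd.pow 2))
      refine mem_of_superset (o.mem_nhds ⟨hy0, hy1, hx0⟩) ?_
      rintro z ⟨a, b, c⟩
      exact ⟨a.le, b.le, c.le⟩
    have hloc : IsLocalMin (fun z => Q z - ε * b z) (x0, y0) := hmin.isLocalMin hKn
    have hOn : O ∈ 𝓝 (x0, y0) := hO.mem_nhds (hKO ⟨h1, h2, h3⟩)
    have cx : Tendsto (fun s : ℝ => (s, y0)) (𝓝 x0) (𝓝 (x0, y0)) :=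
      (Continuous.prodMk continuous_id continuous_const).tendsto x0
    have cy : Tendsto (fun s : ℝ => (x0, s)) (𝓝 y0) (𝓝 (x0, y0)) :=
      (Continuous.prodMk continuous_const continuous_id).tendsto y0
    have tx := slice_test (fun s => Q (s, y0) - ε * b (s, y0))
      (fun s => Qx (s, y0) - ε * (-(s * y0 ^ (3 / 2 : ℝ)))) x0
      (Qxx (x0, y0) - ε * (-(y0 ^ (3 / 2 : ℝ))))
      (by
        filter_upwards [cx hOn] with s hs
        refine (hx (s, y0) hs).sub (HasDerivAt.const_mul ε ?_)
        refine ((((hasDerivAt_pow 2 s).div_const 2).mul_const (y0 ^ (3 / 2 : ℝ))).const_sub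
          (y0 ^ (7 / 2 : ℝ))).congr_deriv ?_
        simp)
      (by
        refine (hxx (x0, y0) (mem_of_mem_nhds hOn)).sub (HasDerivAt.const_mul ε ?_)
        refine (((hasDerivAt_id x0).mul_const (y0 ^ (3 / 2 : ℝ))).neg).congr_deriv ?_
        simp)
      (cx.eventually hloc)
    have ty := slice_test (fun s => Q (x0, s) - ε * b (x0, s))
      (fun s => Qy (x0, s) - ε * (7 / 2 * s ^ (5 / 2 : ℝ) - x0 ^ 2 / 2 * (3 / 2 * s ^ (1 / 2 : ℝ)))) y0
      (Qyy (x0, y0) - ε * (7 / 2 * (5 / 2 * y0 ^ (3 / 2 : ℝ)) - x0 ^ 2 / 2 * (3 / 2 * (1 / 2 * y0 ^ (-1 / 2 : ℝ)))))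
      (by
        filter_upwards [cy hOn, lt_mem_nhds hy0] with s hs hs0
        refine (hy (x0, s) hs).sub (HasDerivAt.const_mul ε ?_)
        refine ((Real.hasDerivAt_rpow_const (p := 7 / 2) (Or.inl hs0.ne')).sub
          ((Real.hasDerivAt_rpow_const (p := 3 / 2) (Or.inl hs0.ne')).const_mul (x0 ^ 2 / 2))).congr_deriv ?_
        norm_num)
      (by
        refine (hyy (x0, y0) (mem_of_mem_nhds hOn)).sub (HasDerivAt.const_mul ε ?_)
        refine (((Real.hasDerivAt_rpow_const (p := 5 / 2) (Or.inl hy0.ne')).const_mul (7 / 2)).sub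
          (((Real.hasDerivAt_rpow_const (p := 1 / 2) (Or.inl hy0.ne')).const_mul (3 / 2)).const_mul
            (x0 ^ 2 / 2))).congr_deriv ?_
        norm_num)
      (cy.eventually hloc)
    obtain ⟨a, b', c, d, e, f⟩ := hgood x0 y0 h1 h2 h3
    have alg := barrier_alg l x0 y0 _ _ _ _ _ _ hl hy0 hY h3 b' c d e f
    have E := heq _ a
    obtain ⟨tx1, tx2⟩ := tx
    obtain ⟨ty1, ty2⟩ := ty
    rw [e52, e12] at ty1
    rw [em12] at ty2
    set Y := y0 ^ (3 / 2 : ℝ) with hYd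
    set A := w (x0, y0) ^ 2 + v (x0, y0) ^ 2 with hA
    have hA0 : 0 ≤ A := by positivity
    rw [show Qx (x0, y0) = ε * (-(x0 * Y)) by linarith,
      show Qy (x0, y0) = ε * (7 / 2 * (y0 * Y) - x0 ^ 2 / 2 * (3 / 2 * (Y / y0))) by linarith] at E
    have hsum : ε * (- Y + (35 / 4 * Y - 3 / 8 * x0 ^ 2 * (Y / y0 ^ 2))) ≤ Qxx (x0, y0) + Qyy (x0, y0) := by
      linarith
    have := mul_le_mul_of_nonneg_left hsum hA0
    have := mul_lt_mul_of_pos_left alg hε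
    linarith
  refine ⟨ε, hε, ρ, hρpos, fun y hy0 hyρ => ?_⟩
  have hK : (0, y) ∈ K := ⟨hy0.le, hyρ.le, by simp; positivity⟩
  have h := hnonneg.trans (hmin hK)
  simp only [b] at h
  simp at h
  exact h


lemma strong_min (O : Set (ℝ × ℝ)) (hO : IsOpen O)
    (Q Qx Qy Qxx Qyy A B1 B2 : ℝ × ℝ → ℝ) (hQc : ContinuousOn Q O)
    (hAc : ContinuousOn A O) (hB1c : ContinuousOn B1 O) (hB2c : ContinuousOn B2 O)
    (hx : ∀ z ∈ O, HasDerivAt (fun s => Q (s, z.2)) (Qx z) z.1)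
    (hxx : ∀ z ∈ O, HasDerivAt (fun s => Qx (s, z.2)) (Qxx z) z.1)
    (hy : ∀ z ∈ O, HasDerivAt (fun s => Q (z.1, s)) (Qy z) z.2)
    (hyy : ∀ z ∈ O, HasDerivAt (fun s => Qy (z.1, s)) (Qyy z) z.2)
    (heq : ∀ z ∈ O, A z * (Qxx z + Qyy z) = B1 z * Qx z + B2 z * Qy z)
    (hA : ∀ z ∈ O, 0 ≤ A z)
    (m : ℝ) (hQ0 : ∀ z ∈ O, m ≤ Q z) (p : ℝ × ℝ) (hp : p ∈ O) (hAp : 0 < A p) (hQp : Q p = m)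
    (hp0 : 0 < p.1 ^ 2 + p.2 ^ 2)
    (hfar : ∀ z ∈ O, Q z = m → z.1 ^ 2 + z.2 ^ 2 ≤ p.1 ^ 2 + p.2 ^ 2) : False := by
  set R2 := p.1 ^ 2 + p.2 ^ 2 with hR2
  let l : ℝ × ℝ → ℝ := fun z => (z.1 + p.1) ^ 2 + (z.2 + p.2) ^ 2 - 4 * R2
  have hlc : Continuous l := by fun_prop
  have hlp : l p = 0 := by simp only [l, hR2]; ring
  set X := B1 p * p.1 + B2 p * p.2 with hX
  set K := |X| / (8 * A p * R2) with hK
  have hKR : K * (8 * A p * R2) = |X| := by rw [hK]; field_simp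
  have hK0 : 0 ≤ K := by positivity
  let h : ℝ × ℝ → ℝ := fun z => l z + K * l z ^ 2
  have hhc : Continuous h := by fun_prop
  have hOn : O ∈ 𝓝 p := hO.mem_nhds hp
  let G : ℝ × ℝ → ℝ := fun z => A z * (4 * (1 + 2 * K * l z) + 8 * K * ((z.1 + p.1) ^ 2 + (z.2 + p.2) ^ 2))
    - 2 * (1 + 2 * K * l z) * (B1 z * (z.1 + p.1) + B2 z * (z.2 + p.2))
  have hG : ContinuousAt G p := by
    have a1 := hAc.continuousAt hOn
    have a2 := hB1c.continuousAt hOn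
    have a3 := hB2c.continuousAt hOn
    fun_prop
  have hGp : 0 < G p := by
    have : G p = 4 * A p + 4 * (K * (8 * A p * R2)) - 4 * X := by
      simp only [G, hlp, hX, hR2]; ring
    rw [this, hKR]
    linarith [le_abs_self X]
  have hkl : ContinuousAt (fun z => 1 + K * l z) p := by fun_prop
  have hev : ∀ᶠ z in 𝓝 p, z ∈ O ∧ 0 < G z ∧ 0 < 1 + K * l z := by
    filter_upwards [hOn, hG.eventually (lt_mem_nhds hGp),
      hkl.eventually (lt_mem_nhds (by simp [hlp] : (0:ℝ) < 1 + K * l p))] with z a b c using ⟨a, b, c⟩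
  obtain ⟨r, hr, hball⟩ := Metric.nhds_basis_closedBall.eventually_iff.1 hev
  have hsub : closedBall p r ⊆ O := fun z hz => (hball hz).1
  have hsep : ∀ z ∈ O, Q z = m → 0 ≤ l z → z = p := by
    intro z hz hq hl
    have h1 := hfar z hz hq
    have h2 : l z = 2 * (z.1 ^ 2 + z.2 ^ 2) - ((z.1 - p.1) ^ 2 + (z.2 - p.2) ^ 2) - 2 * R2 := by
      simp only [l, hR2]; ring
    have h3 : (z.1 - p.1) ^ 2 + (z.2 - p.2) ^ 2 ≤ 0 := by linarith
    have h4 : z.1 - p.1 = 0 := by nlinarith [sq_nonneg (z.1 - p.1), sq_nonneg (z.2 - p.2)]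
    have h5 : z.2 - p.2 = 0 := by nlinarith [sq_nonneg (z.1 - p.1), sq_nonneg (z.2 - p.2)]
    ext <;> linarith
  let S : Set (ℝ × ℝ) := sphere p r ∩ {z | 0 ≤ h z}
  have hSc : IsCompact S := (isCompact_sphere p r).inter_right (isClosed_le continuous_const hhc)
  have hSs : S ⊆ O := fun z hz => hsub (sphere_subset_closedBall hz.1)
  obtain ⟨ε, hε, hεS⟩ := exists_eps S hSc (fun z => Q z - m) h
    ((hQc.mono hSs).sub continuousOn_const) hhc.continuousOn
    (by
      intro z hz
      have hzO := hSs hz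
      have hle := hQ0 z hzO
      rcases hle.lt_or_eq with h' | h'
      · linarith
      · exfalso
        have hpos := (hball (sphere_subset_closedBall hz.1)).2.2
        have hl : 0 ≤ l z := by
          have h2 : 0 ≤ l z * (1 + K * l z) := by
            have : 0 ≤ h z := hz.2
            simp only [h] at this
            nlinarith
          exact nonneg_of_mul_nonneg_left h2 hpos
        have := hsep z hzO h'.symm hl
        have hs := hz.1
        rw [this, mem_sphere, dist_self] at hs
        exact hr.ne hs)
  obtain ⟨z0, hz0, hmin⟩ := (isCompact_closedBall p r).exists_isMinOn (f := fun z => Q z - ε * h z)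
    ⟨p, mem_closedBall_self hr.le⟩ ((hQc.mono hsub).sub (hhc.const_mul ε).continuousOn)
  have hval : Q z0 - ε * h z0 ≤ m := by
    have := hmin (mem_closedBall_self hr.le)
    simp only [mem_ofPred_eq, h, hlp, hQp] at this
    simp only [h]
    linarith
  have hz0O := hsub hz0
  have hz0ball : z0 ∈ ball p r := by
    rcases (mem_closedBall.1 hz0).lt_or_eq with h' | h'
    · exact h'
    · exfalso
      by_cases hh : 0 ≤ h z0
      · have := hεS z0 ⟨h', hh⟩
        linarith
      · push Not at hh
        have := hQ0 z0 hz0O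
        nlinarith
  have hloc : IsLocalMin (fun z => Q z - ε * h z) z0 :=
    hmin.isLocalMin (mem_of_superset (isOpen_ball.mem_nhds hz0ball) ball_subset_closedBall)
  have hOz : O ∈ 𝓝 z0 := hO.mem_nhds hz0O
  have hGz := (hball hz0).2.1
  have hAz := hA z0 hz0O
  have E := heq z0 hz0O
  obtain ⟨x0, y0⟩ := z0
  have cx : Tendsto (fun s : ℝ => (s, y0)) (𝓝 x0) (𝓝 (x0, y0)) :=
    (Continuous.prodMk continuous_id continuous_const).tendsto x0
  have cy : Tendsto (fun s : ℝ => (x0, s)) (𝓝 y0) (𝓝 (x0, y0)) :=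
    (Continuous.prodMk continuous_const continuous_id).tendsto y0
  have lx : ∀ s, HasDerivAt (fun s => l (s, y0)) (2 * (s + p.1)) s := by
    intro s
    refine (((((hasDerivAt_id s).add_const p.1).pow 2).add_const ((y0 + p.2) ^ 2)).sub_const (4 * R2)).congr_deriv ?_
    simp
  have ly : ∀ s, HasDerivAt (fun s => l (x0, s)) (2 * (s + p.2)) s := by
    intro s
    refine (((((hasDerivAt_id s).add_const p.2).pow 2).const_add ((x0 + p.1) ^ 2)).sub_const (4 * R2)).congr_deriv ?_
    simp
  have tx := slice_test (fun s => Q (s, y0) - ε * h (s, y0))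
    (fun s => Qx (s, y0) - ε * (2 * (s + p.1) * (1 + 2 * K * l (s, y0)))) x0
    (Qxx (x0, y0) - ε * (2 * (1 + 2 * K * l (x0, y0)) + 8 * K * (x0 + p.1) ^ 2))
    (by
      filter_upwards [cx hOz] with s hs
      refine (hx (s, y0) hs).sub (HasDerivAt.const_mul ε ?_)
      refine ((lx s).add (((lx s).pow 2).const_mul K)).congr_deriv ?_
      simp; ring)
    (by
      refine (hxx (x0, y0) hz0O).sub (HasDerivAt.const_mul ε ?_)
      refine ((((hasDerivAt_id x0).add_const p.1).const_mul 2).mul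
        (((lx x0).const_mul (2 * K)).const_add 1)).congr_deriv ?_
      simp; ring)
    (cx.eventually hloc)
  have ty := slice_test (fun s => Q (x0, s) - ε * h (x0, s))
    (fun s => Qy (x0, s) - ε * (2 * (s + p.2) * (1 + 2 * K * l (x0, s)))) y0
    (Qyy (x0, y0) - ε * (2 * (1 + 2 * K * l (x0, y0)) + 8 * K * (y0 + p.2) ^ 2))
    (by
      filter_upwards [cy hOz] with s hs
      refine (hy (x0, s) hs).sub (HasDerivAt.const_mul ε ?_)
      refine ((ly s).add (((ly s).pow 2).const_mul K)).congr_deriv ?_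
      simp; ring)
    (by
      refine (hyy (x0, y0) hz0O).sub (HasDerivAt.const_mul ε ?_)
      refine ((((hasDerivAt_id y0).add_const p.2).const_mul 2).mul
        (((ly y0).const_mul (2 * K)).const_add 1)).congr_deriv ?_
      simp; ring)
    (cy.eventually hloc)
  obtain ⟨tx1, tx2⟩ := tx
  obtain ⟨ty1, ty2⟩ := ty
  rw [show Qx (x0, y0) = ε * (2 * (x0 + p.1) * (1 + 2 * K * l (x0, y0))) by linarith,
    show Qy (x0, y0) = ε * (2 * (y0 + p.2) * (1 + 2 * K * l (x0, y0))) by linarith] at E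
  have hsum : ε * (4 * (1 + 2 * K * l (x0, y0)) + 8 * K * ((x0 + p.1) ^ 2 + (y0 + p.2) ^ 2))
      ≤ Qxx (x0, y0) + Qyy (x0, y0) := by linarith
  have i1 := mul_le_mul_of_nonneg_left hsum hAz
  have i2 := mul_pos hε hGz
  simp only [G] at i2
  linarith

/-- slices of a smooth function -/
lemma slice_x {V : Set (ℝ × ℝ)} {g : ℝ × ℝ → ℝ} (hV : IsOpen V) (hg : ContDiffOn ℝ (⊤ : ℕ∞) g V)
    {z : ℝ × ℝ} (hz : z ∈ V) : HasDerivAt (fun s => g (s, z.2)) (dir (1, 0) g z) z.1 :=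
  dir_curve (c := fun s => (s, z.2)) (smooth_diff hV hg hz)
    ((hasDerivAt_id z.1).prodMk (hasDerivAt_const z.1 z.2)) rfl

lemma slice_y {V : Set (ℝ × ℝ)} {g : ℝ × ℝ → ℝ} (hV : IsOpen V) (hg : ContDiffOn ℝ (⊤ : ℕ∞) g V)
    {z : ℝ × ℝ} (hz : z ∈ V) : HasDerivAt (fun s => g (z.1, s)) (dir (0, 1) g z) z.2 :=
  dir_curve (c := fun s => (z.1, s)) (smooth_diff hV hg hz)
    ((hasDerivAt_const z.2 z.1).prodMk (hasDerivAt_id z.2)) rfl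

lemma slice_v {V : Set (ℝ × ℝ)} {g : ℝ × ℝ → ℝ} (hV : IsOpen V) (hg : ContDiffOn ℝ (⊤ : ℕ∞) g V)
    (q v : ℝ × ℝ) (t : ℝ) (hz : q + t • v ∈ V) :
    HasDerivAt (fun s : ℝ => g (q + s • v)) (dir v g (q + t • v)) t :=
  dir_curve (c := fun s : ℝ => q + s • v) (smooth_diff hV hg hz)
    (by simpa using ((hasDerivAt_id t).smul_const v).const_add q) rfl

/-- growth along a segment -/
lemma seg_growth {V : Set (ℝ × ℝ)} {g : ℝ × ℝ → ℝ} (hV : IsOpen V) (hg : ContDiffOn ℝ (⊤ : ℕ∞) g V)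
    (q v : ℝ × ℝ) (δ c : ℝ) (hδ : 0 < δ) (hin : ∀ t ∈ Icc 0 δ, q + t • v ∈ V)
    (hc : ∀ t ∈ Icc 0 δ, c ≤ dir v g (q + t • v)) : g q + c * δ ≤ g (q + δ • v) := by
  obtain ⟨t, ht, h⟩ := exists_hasDerivAt_eq_slope (fun s : ℝ => g (q + s • v))
    (fun s => dir v g (q + s • v)) hδ
    (fun s hs => (slice_v hV hg q v s (hin s hs)).continuousAt.continuousWithinAt)
    (fun s hs => slice_v hV hg q v s (hin s (Ioo_subset_Icc_self hs)))
  have := hc t (Ioo_subset_Icc_self ht)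
  rw [h, sub_zero, le_div_iff₀ hδ] at this
  simp at this
  linarith


section
variable {g h : ℝ × ℝ → ℝ} {p : ℝ × ℝ}
lemma dir_mul (v : ℝ × ℝ) (hg : DifferentiableAt ℝ g p) (hh : DifferentiableAt ℝ h p) :
    dir v (fun z => g z * h z) p = g p * dir v h p + h p * dir v g p := by
  unfold dir; rw [fderiv_fun_mul hg hh]; simp

lemma dir_sub (v : ℝ × ℝ) (hg : DifferentiableAt ℝ g p) (hh : DifferentiableAt ℝ h p) :
    dir v (fun z => g z - h z) p = dir v g p - dir v h p := by
  unfold dir; rw [fderiv_fun_sub hg hh]; simp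
end

lemma frame {V Ω : Set (ℝ × ℝ)} (hV : IsOpen V) (hΩ : IsOpen Ω) (hΩV : Ω ⊆ V) {U Q : ℝ × ℝ → ℝ}
    (hU : ContDiffOn ℝ (⊤ : ℕ∞) U V) (f F : ℝ → ℝ)
    (hF : ∀ t, HasDerivAt F (f t) t) (c : ℝ) (e n : ℝ × ℝ)
    (hQ : ∀ z ∈ V, Q z = c - ((dir e U z ^ 2 + dir n U z ^ 2) / 2 + F (U z)))
    (hpde : ∀ z ∈ Ω, dir e (dir e U) z + dir n (dir n U) z = - f (U z)) :
    ∀ z ∈ Ω, dir e Q z = dir e U z * dir n (dir n U) z - dir n U z * dir e (dir n U) z ∧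
      dir n Q z = dir n U z * dir e (dir e U) z - dir e U z * dir e (dir n U) z ∧
      (dir e U z ^ 2 + dir n U z ^ 2) * (dir e (dir e Q) z + dir n (dir n Q) z) =
        2 * (dir e U z * dir e (dir e U) z + dir n U z * dir e (dir n U) z) * dir e Q z +
        2 * (dir e U z * dir e (dir n U) z + dir n U z * dir n (dir n U) z) * dir n Q z ∧
      (dir e U z = 0 → dir n U z = 0 → dir n (dir n Q) z =
        dir e (dir e U) z * dir n (dir n U) z - dir e (dir n U) z ^ 2) := by
  have sv := fun v => dir_smooth hV hU v
  have svw := fun v w => dir_smooth hV (sv w) v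
  have grad : ∀ v, ∀ z ∈ V, dir v Q z =
      -(dir e U z * dir v (dir e U) z + dir n U z * dir v (dir n U) z + f (U z) * dir v U z) := by
    intro v z hz
    rw [dir_congr hV hQ hz]
    have d1 := (smooth_diff hV (sv e) hz).hasFDerivAt
    have d2 := (smooth_diff hV (sv n) hz).hasFDerivAt
    have d3 := (smooth_diff hV hU hz).hasFDerivAt
    have := (((((d1.pow 2).add (d2.pow 2)).mul_const (2⁻¹ : ℝ)).add ((hF (U z)).comp_hasFDerivAt z d3)).const_sub c)
    have h2 : HasFDerivAt (fun z => c - ((dir e U z ^ 2 + dir n U z ^ 2) / 2 + F (U z))) _ z := this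
    unfold dir at h2 ⊢
    rw [h2.fderiv]
    simp
    ring
  have ge : ∀ z ∈ Ω, dir e Q z = dir e U z * dir n (dir n U) z - dir n U z * dir e (dir n U) z := by
    intro z hz
    rw [grad e z (hΩV hz)]
    linear_combination (-dir e U z) * (hpde z hz)
  have gn : ∀ z ∈ Ω, dir n Q z = dir n U z * dir e (dir e U) z - dir e U z * dir e (dir n U) z := by
    intro z hz
    rw [grad n z (hΩV hz), dir_comm hV hU (hΩV hz) n e]
    linear_combination (-dir n U z) * (hpde z hz)
  have gee : ∀ z ∈ Ω, dir e (dir e Q) z = dir e U z * dir e (dir n (dir n U)) z + dir n (dir n U) z * dir e (dir e U) z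
      - (dir n U z * dir e (dir e (dir n U)) z + dir e (dir n U) z * dir e (dir n U) z) := by
    intro z hz
    have hz' := hΩV hz
    rw [dir_congr hΩ ge hz, dir_sub, dir_mul, dir_mul]
    · exact smooth_diff hV (sv n) hz'
    · exact smooth_diff hV (svw e n) hz'
    · exact smooth_diff hV (sv e) hz'
    · exact smooth_diff hV (svw n n) hz'
    · exact (smooth_diff hV (sv e) hz').mul (smooth_diff hV (svw n n) hz')
    · exact (smooth_diff hV (sv n) hz').mul (smooth_diff hV (svw e n) hz')
  have gnn : ∀ z ∈ Ω, dir n (dir n Q) z = dir n U z * dir n (dir e (dir e U)) z + dir e (dir e U) z * dir n (dir n U) z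
      - (dir e U z * dir n (dir e (dir n U)) z + dir e (dir n U) z * dir e (dir n U) z) := by
    intro z hz
    have hz' := hΩV hz
    rw [dir_congr hΩ gn hz, dir_sub, dir_mul, dir_mul, dir_comm hV hU hz' n e]
    · exact smooth_diff hV (sv e) hz'
    · exact smooth_diff hV (svw e n) hz'
    · exact smooth_diff hV (sv n) hz'
    · exact smooth_diff hV (svw e e) hz'
    · exact (smooth_diff hV (sv n) hz').mul (smooth_diff hV (svw e e) hz')
    · exact (smooth_diff hV (sv e) hz').mul (smooth_diff hV (svw e n) hz')
  intro z hz
  have hz' := hΩV hz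
  refine ⟨ge z hz, gn z hz, ?_, ?_⟩
  · have t1 : dir e (dir n (dir n U)) z = dir n (dir e (dir n U)) z := dir_comm hV (sv n) hz' e n
    have t2 : dir n (dir e (dir e U)) z = dir e (dir e (dir n U)) z := by
      rw [dir_comm hV (sv e) hz' n e]
      exact dir_congr hV (fun q hq => dir_comm hV hU hq n e) hz' e
    rw [gee z hz, gnn z hz, ge z hz, gn z hz, t1, t2]
    ring
  · intro h1 h2
    rw [gnn z hz, h1, h2]; ring

lemma stay {Ω s : Set (ℝ × ℝ)} (hΩ : IsOpen Ω) (hs : IsPreconnected s) (hd : ∀ z ∈ s, z ∉ frontier Ω)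
    (hne : (s ∩ Ω).Nonempty) : s ⊆ Ω := by
  refine hs.subset_left_of_subset_union hΩ isClosed_closure.isOpen_compl
    (disjoint_compl_right_iff_subset.2 subset_closure) ?_ hne
  intro z hz
  by_cases h : z ∈ closure Ω
  · left
    by_contra hn
    exact hd z hz ⟨h, by rwa [hΩ.interior_eq]⟩
  · exact Or.inr h

/-- The minimum over the closure is not attained at a boundary point. -/
lemma not_boundary {V Ω : Set (ℝ × ℝ)} (hV : IsOpen V) (hΩ : IsOpen Ω) (hΩV : closure Ω ⊆ V)
    {U Q : ℝ × ℝ → ℝ} (hU : ContDiffOn ℝ (⊤ : ℕ∞) U V) (hQ : ContDiffOn ℝ (⊤ : ℕ∞) Q V)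
    (hpos : ∀ z ∈ Ω, 0 < U z) (hbc : ∀ z ∈ frontier Ω, U z = 0) (p d : ℝ × ℝ)
    (hp : p ∈ frontier Ω) (h1 : 0 < dir d U p) (h2 : dir d Q p < 0) : ∃ z ∈ Ω, Q z < Q p := by
  have hpc : p ∈ closure Ω := frontier_subset_closure hp
  have hpV : V ∈ 𝓝 p := hV.mem_nhds (hΩV hpc)
  have c1 := (dir_smooth hV hU d).continuousOn.continuousAt hpV
  have c2 := (dir_smooth hV hQ d).continuousOn.continuousAt hpV
  set c := - dir d Q p / 2 with hc
  have hcpos : 0 < c := by rw [hc]; linarith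
  have hev : ∀ᶠ z in 𝓝 p, z ∈ V ∧ 0 < dir d U z ∧ dir d Q z < -c := by
    filter_upwards [hpV, c1.eventually (lt_mem_nhds h1),
      c2.eventually (gt_mem_nhds (show dir d Q p < -c by rw [hc]; linarith))] with z a b e using ⟨a, b, e⟩
  obtain ⟨r, hr, hball⟩ := Metric.eventually_nhds_iff_ball.1 hev
  set δ := r / (2 * (‖d‖ + 1)) with hδ
  have hd0 : 0 ≤ ‖d‖ := norm_nonneg d
  have hδpos : 0 < δ := by positivity
  have hδd : δ * ‖d‖ ≤ r / 2 := by
    have : δ * (‖d‖ + 1) = r / 2 := by rw [hδ]; field_simp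
    nlinarith
  have hQc := hQ.continuousOn.continuousAt hpV
  have hev2 : ∀ᶠ z in 𝓝 p, z ∈ ball p (r / 2) ∧ Q z < Q p + c * δ := by
    filter_upwards [ball_mem_nhds p (half_pos hr), hQc.eventually (gt_mem_nhds
      (show Q p < Q p + c * δ by have := mul_pos hcpos hδpos; linarith))] with z a b using ⟨a, b⟩
  obtain ⟨q, hqΩ, hqb, hqQ⟩ := ((mem_closure_iff_frequently.1 hpc).and_eventually hev2).exists
  have hin : ∀ t ∈ Icc 0 δ, q + t • d ∈ ball p r := by
    intro t ht
    rw [mem_ball, dist_eq_norm] at hqb ⊢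
    have : q + t • d - p = (q - p) + t • d := by abel
    rw [this]
    refine (norm_add_le _ _).trans_lt ?_
    rw [norm_smul, Real.norm_eq_abs, abs_of_nonneg ht.1]
    have : t * ‖d‖ ≤ δ * ‖d‖ := by gcongr; exact ht.2
    linarith
  have hUp : ∀ t ∈ Icc 0 δ, 0 < U (q + t • d) := by
    intro t ht
    rcases ht.1.eq_or_lt with h | h
    · rw [← h]; simpa using hpos q hqΩ
    · have := seg_growth hV hU q d t 0 h
        (fun s hs => (hball _ (hin s ⟨hs.1, hs.2.trans ht.2⟩)).1)
        (fun s hs => (hball _ (hin s ⟨hs.1, hs.2.trans ht.2⟩)).2.1.le)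
      have := hpos q hqΩ
      linarith
  have hst : (fun t : ℝ => q + t • d) '' Icc 0 δ ⊆ Ω := by
    apply stay hΩ
    · exact isPreconnected_Icc.image _ (by fun_prop)
    · rintro _ ⟨t, ht, rfl⟩ hfr
      have := hUp t ht
      have := hbc _ hfr
      linarith
    · exact ⟨q, ⟨0, ⟨le_rfl, hδpos.le⟩, by simp⟩, hqΩ⟩
  refine ⟨q + δ • d, hst ⟨δ, ⟨hδpos.le, le_rfl⟩, rfl⟩, ?_⟩
  have hnQ : ContDiffOn ℝ (⊤ : ℕ∞) (fun z => - Q z) V := hQ.neg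
  have := seg_growth hV hnQ q d δ c hδpos (fun s hs => (hball _ (hin s hs)).1)
    (fun s hs => by
      have a := (hball _ (hin s hs)).2.2
      have : dir d (fun z => - Q z) (q + s • d) = - dir d Q (q + s • d) := by
        unfold dir; rw [fderiv_fun_neg]; simp
      rw [this]; linarith)
  linarith

lemma global_min {V Ω : Set (ℝ × ℝ)} (hV : IsOpen V) (hΩ : IsOpen Ω) (hΩV : closure Ω ⊆ V)
    (hbdd : Bornology.IsBounded Ω) (h0 : ((0, 0) : ℝ × ℝ) ∈ Ω)
    {U Q : ℝ × ℝ → ℝ} (hU : ContDiffOn ℝ (⊤ : ℕ∞) U V) (hQ : ContDiffOn ℝ (⊤ : ℕ∞) Q V)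
    (hpos : ∀ z ∈ Ω, 0 < U z) (hbc : ∀ z ∈ frontier Ω, U z = 0)
    (hbd : ∀ p ∈ frontier Ω, ∃ d, 0 < dir d U p ∧ dir d Q p < 0)
    (A B1 B2 : ℝ × ℝ → ℝ)
    (hAc : ContinuousOn A Ω) (hB1c : ContinuousOn B1 Ω) (hB2c : ContinuousOn B2 Ω)
    (heq : ∀ z ∈ Ω, A z * (dir (1, 0) (dir (1, 0) Q) z + dir (0, 1) (dir (0, 1) Q) z)
      = B1 z * dir (1, 0) Q z + B2 z * dir (0, 1) Q z)
    (hA : ∀ z ∈ Ω, 0 ≤ A z) (hA0 : ∀ z ∈ Ω, A z = 0 → z = (0, 0)) :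
    ∀ z ∈ Ω, z ≠ (0, 0) → Q (0, 0) < Q z := by
  have hΩV' : Ω ⊆ V := subset_closure.trans hΩV
  have hcomp : IsCompact (closure Ω) := hbdd.isCompact_closure
  have hQc : ContinuousOn Q (closure Ω) := hQ.continuousOn.mono hΩV
  obtain ⟨m, hm, hmin⟩ := hcomp.exists_isMinOn ⟨_, subset_closure h0⟩ hQc
  let Z : Set (ℝ × ℝ) := {z | z ∈ closure Ω ∧ Q z = Q m}
  have hZc : IsCompact Z :=
    hcomp.of_isClosed_subset (hQc.preimage_isClosed_of_isClosed isClosed_closure isClosed_singleton)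
      (fun z hz => hz.1)
  have hZΩ : Z ⊆ Ω := by
    intro z hz
    by_contra hn
    have hfr : z ∈ frontier Ω := ⟨hz.1, by rwa [hΩ.interior_eq]⟩
    obtain ⟨d, d1, d2⟩ := hbd z hfr
    obtain ⟨y, hy, hlt⟩ := not_boundary hV hΩ hΩV hU hQ hpos hbc z d hfr d1 d2
    have : Q m ≤ Q y := hmin (subset_closure hy)
    rw [hz.2] at hlt
    linarith
  have hZ0 : ∀ z ∈ Z, z = (0, 0) := by
    by_contra hcon
    push Not at hcon
    obtain ⟨z, hz, hzne⟩ := hcon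
    obtain ⟨p, hp, hpmax⟩ := hZc.exists_isMaxOn (f := fun z : ℝ × ℝ => z.1 ^ 2 + z.2 ^ 2) ⟨z, hz⟩
      (by fun_prop)
    have hz2 : 0 < z.1 ^ 2 + z.2 ^ 2 := by
      by_contra hn
      push Not at hn
      apply hzne
      have h4 : z.1 = 0 := by nlinarith [sq_nonneg z.1, sq_nonneg z.2]
      have h5 : z.2 = 0 := by nlinarith [sq_nonneg z.1, sq_nonneg z.2]
      exact Prod.ext h4 h5
    have hp0 : 0 < p.1 ^ 2 + p.2 ^ 2 := lt_of_lt_of_le hz2 (hpmax hz)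
    have hpΩ := hZΩ hp
    have hAp : 0 < A p := by
      refine lt_of_le_of_ne (hA p hpΩ) fun h => ?_
      have := hA0 p hpΩ h.symm
      rw [this] at hp0
      simp at hp0
    exact strong_min Ω hΩ Q _ _ _ _ A B1 B2 (hQc.mono subset_closure) hAc hB1c hB2c
      (fun z hz => slice_x hV hQ (hΩV' hz)) (fun z hz => slice_x hV (dir_smooth hV hQ _) (hΩV' hz))
      (fun z hz => slice_y hV hQ (hΩV' hz)) (fun z hz => slice_y hV (dir_smooth hV hQ _) (hΩV' hz))
      heq hA (Q m) (fun z hz => hmin (subset_closure hz)) p hpΩ hAp hp.2 hp0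
      (fun z hz hq => hpmax (show z ∈ Z from ⟨subset_closure hz, hq⟩))
  have hm0 : m = (0, 0) := hZ0 m ⟨hm, rfl⟩
  intro z hz hne
  refine lt_of_le_of_ne ?_ fun h => ?_
  · rw [← hm0]; exact hmin (subset_closure hz)
  · exact hne (hZ0 z ⟨subset_closure hz, by rw [hm0, h]⟩)


/-- The Hessian cannot vanish: a Gronwall argument. -/
lemma gron {V Ω : Set (ℝ × ℝ)} (hV : IsOpen V) (hΩ : IsOpen Ω) (hΩV : Ω ⊆ V)
    (h0 : ((0, 0) : ℝ × ℝ) ∈ Ω) {U : ℝ × ℝ → ℝ} (hU : ContDiffOn ℝ (⊤ : ℕ∞) U V)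
    (f F : ℝ → ℝ) (hf : ContDiff ℝ (⊤ : ℕ∞) f) (hF : ∀ t, HasDerivAt F (f t) t)
    (hle : ∀ z ∈ Ω, (dir (1, 0) U z ^ 2 + dir (0, 1) U z ^ 2) / 2 + F (U z) ≤ F (U (0, 0)))
    (hfM : f (U (0, 0)) = 0)
    (huniq : ∀ z ∈ Ω, dir (1, 0) U z = 0 → dir (0, 1) U z = 0 → z = (0, 0)) : False := by
  set M := U (0, 0) with hM
  have hfd : DifferentiableAt ℝ f M := hf.contDiffAt.differentiableAt (by simp)
  obtain ⟨k, hk⟩ := hfd.isBigO_sub.bound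
  have hk' : ∀ᶠ t in 𝓝 M, |f t| ≤ (|k| + 1) * |t - M| := by
    filter_upwards [hk] with t ht
    rw [hfM, sub_zero, Real.norm_eq_abs, Real.norm_eq_abs] at ht
    refine ht.trans ?_
    gcongr
    linarith [le_abs_self k]
  set L := |k| + 1 with hL
  have hLpos : 0 < L := by positivity
  obtain ⟨r, hr, hball⟩ := Metric.eventually_nhds_iff_ball.1 hk'
  have hFb : ∀ t ∈ ball M r, |F t - F M| ≤ L * |t - M| ^ 2 := by
    intro t ht
    have := mv_chain (ρ := r) (C := L) (k := 1) (g := fun s => F (M + s) - F M) (g' := fun s => f (M + s))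
      hLpos.le
      (fun s _ => by
        have := (hF (M + s)).comp_const_add M s
        exact this.sub_const _)
      (fun s hs => by
        have := hball (M + s) (by rw [mem_ball, Real.dist_eq]; simpa using hs)
        simpa using this) (by simp) (t - M) (by rwa [mem_ball, Real.dist_eq] at ht)
    simpa using this
  have hUc : ContinuousAt U (0, 0) := hU.continuousOn.continuousAt (hV.mem_nhds (hΩV h0))
  have hev : ∀ᶠ z in 𝓝 ((0, 0) : ℝ × ℝ), z ∈ Ω ∧ U z ∈ ball M r := by
    filter_upwards [hΩ.mem_nhds h0, hUc.eventually (ball_mem_nhds M hr)] with z a b using ⟨a, b⟩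
  obtain ⟨δ, hδ, hb⟩ := Metric.eventually_nhds_iff_ball.1 hev
  have hgr : ∀ z ∈ ball ((0, 0) : ℝ × ℝ) δ,
      dir (1, 0) U z ^ 2 + dir (0, 1) U z ^ 2 ≤ 2 * L * (U z - M) ^ 2 := by
    intro z hz
    have h1 := hle z (hb z hz).1
    have h2 := (abs_le.1 (hFb _ (hb z hz).2)).1
    rw [sq_abs] at h2
    linarith
  have hin : ∀ t ∈ Icc 0 (δ / 2), ((t, 0) : ℝ × ℝ) ∈ ball ((0, 0) : ℝ × ℝ) δ := by
    intro t ht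
    rw [mem_ball, Prod.dist_eq]
    simp only [Real.dist_eq, sub_zero, abs_zero, abs_of_nonneg ht.1]
    exact max_lt (by linarith [ht.2]) hδ
  have hder : ∀ t ∈ Icc 0 (δ / 2), HasDerivAt (fun s => U (s, 0) - M) (dir (1, 0) U (t, 0)) t := by
    intro t ht
    exact (slice_x hV hU (z := (t, 0)) (hΩV (hb _ (hin t ht)).1)).sub_const M
  have hz := eq_zero_of_abs_deriv_le_mul_abs_self_of_eq_zero_right (f := fun s => U (s, 0) - M)
    (f' := fun t => dir (1, 0) U (t, 0)) (K := 2 * L + 1) (a := 0) (b := δ / 2)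
    (fun t ht => (hder t ht).continuousAt.continuousWithinAt)
    (fun t ht => (hder t (Ico_subset_Icc_self ht)).hasDerivWithinAt) (by simp [hM])
    (by
      intro t ht
      have h1 := hgr _ (hin t (Ico_subset_Icc_self ht))
      rw [Real.norm_eq_abs, Real.norm_eq_abs]
      apply abs_le_of_sq_le_sq _ (by positivity) |> fun h => h
      rw [mul_pow, sq_abs]
      have h3 : 2 * L ≤ (2 * L + 1) ^ 2 := by nlinarith
      have h4 := mul_le_mul_of_nonneg_right h3 (sq_nonneg (U (t, 0) - M))
      nlinarith [sq_nonneg (dir (0, 1) U (t, 0))])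
    (δ / 2) ⟨by linarith, le_rfl⟩
  have hmem : δ / 2 ∈ Icc 0 (δ / 2) := ⟨by linarith, le_rfl⟩
  have h1 := hgr _ (hin _ hmem)
  rw [hz] at h1
  have h2 := huniq (δ / 2, 0) (hb _ (hin _ hmem)).1
    (by nlinarith [sq_nonneg (dir (1, 0) U (δ / 2, 0)), sq_nonneg (dir (0, 1) U (δ / 2, 0))])
    (by nlinarith [sq_nonneg (dir (1, 0) U (δ / 2, 0)), sq_nonneg (dir (0, 1) U (δ / 2, 0))])
  have := congrArg Prod.fst h2
  simp at this
  linarith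

/-- rotated coordinates -/
def rot (e n : ℝ × ℝ) (z : ℝ × ℝ) : ℝ × ℝ := z.1 • e + z.2 • n

lemma rot_cont (e n : ℝ × ℝ) : Continuous (rot e n) := by unfold rot; fun_prop

lemma rot_zero (e n : ℝ × ℝ) : rot e n (0, 0) = (0, 0) := by simp [rot]; rfl

lemma rot_x {V : Set (ℝ × ℝ)} {g : ℝ × ℝ → ℝ} (hV : IsOpen V) (hg : ContDiffOn ℝ (⊤ : ℕ∞) g V)
    (e n z : ℝ × ℝ) (hz : rot e n z ∈ V) :
    HasDerivAt (fun s => g (rot e n (s, z.2))) (dir e g (rot e n z)) z.1 :=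
  dir_curve (c := fun s => rot e n (s, z.2)) (smooth_diff hV hg hz)
    (by simpa [rot] using ((hasDerivAt_id z.1).smul_const e).add_const (z.2 • n)) rfl

lemma rot_y {V : Set (ℝ × ℝ)} {g : ℝ × ℝ → ℝ} (hV : IsOpen V) (hg : ContDiffOn ℝ (⊤ : ℕ∞) g V)
    (e n z : ℝ × ℝ) (hz : rot e n z ∈ V) :
    HasDerivAt (fun s => g (rot e n (z.1, s))) (dir n g (rot e n z)) z.2 :=
  dir_curve (c := fun s => rot e n (z.1, s)) (smooth_diff hV hg hz)
    (by simpa [rot] using ((hasDerivAt_id z.2).smul_const n).const_add (z.1 • e)) rfl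

lemma rot_o {g : ℝ × ℝ → ℝ} (e n : ℝ × ℝ) (hg : DifferentiableAt ℝ g (0, 0)) (h0 : g (0, 0) = 0) :
    (fun z : ℝ × ℝ => g (rot e n z) - (z.1 * dir e g (0, 0) + z.2 * dir n g (0, 0)))
      =o[𝓝 (0, 0)] (fun z => z) := by
  let R : ℝ × ℝ →L[ℝ] ℝ × ℝ :=
    (ContinuousLinearMap.fst ℝ ℝ ℝ).smulRight e + (ContinuousLinearMap.snd ℝ ℝ ℝ).smulRight n
  have hR : HasFDerivAt (rot e n) R (0, 0) := R.hasFDerivAt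
  have hg' : HasFDerivAt g (fderiv ℝ g (0, 0)) (rot e n (0, 0)) := by
    rw [rot_zero]; exact hg.hasFDerivAt
  have := (hg'.comp (0, 0) hR).isLittleO
  refine (this.congr_left ?_).congr_right ?_
  · intro z
    simp [R, rot_zero, h0, dir]
  · intro z; simp

lemma local_contra {V Ω : Set (ℝ × ℝ)} (hV : IsOpen V) (hΩ : IsOpen Ω) (hΩV : Ω ⊆ V)
    (h0 : ((0, 0) : ℝ × ℝ) ∈ Ω) {U Q : ℝ × ℝ → ℝ} (hU : ContDiffOn ℝ (⊤ : ℕ∞) U V)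
    (hQ : ContDiffOn ℝ (⊤ : ℕ∞) Q V) (a b : ℝ) (hab : a ^ 2 + b ^ 2 = 1) (e n : ℝ × ℝ)
    (he : e = (a, b)) (hn : n = (-b, a)) (hQ0 : Q (0, 0) = 0)
    (hQpos : ∀ z ∈ Ω, z ≠ (0, 0) → 0 < Q z)
    (heq : ∀ z ∈ Ω, (dir e U z ^ 2 + dir n U z ^ 2) * (dir e (dir e Q) z + dir n (dir n Q) z) =
        2 * (dir e U z * dir e (dir e U) z + dir n U z * dir e (dir n U) z) * dir e Q z +
        2 * (dir e U z * dir e (dir n U) z + dir n U z * dir n (dir n U) z) * dir n Q z)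
    (he0 : dir e U (0, 0) = 0) (hn0 : dir n U (0, 0) = 0)
    (hee : dir e (dir e U) (0, 0) = 0) (hen : dir e (dir n U) (0, 0) = 0)
    (hnn : dir n (dir n U) (0, 0) ≠ 0) (hQn : dir n Q (0, 0) = 0)
    (hQnn : dir n (dir n Q) (0, 0) = 0) : False := by
  have h0V := hΩV h0
  have sv := fun v => dir_smooth hV hU v
  have svw := fun v w => dir_smooth hV (sv w) v
  have q1 := fun v => dir_smooth hV hQ v
  have rc := rot_cont e n
  have r0 := rot_zero e n
  have hQge : ∀ z ∈ Ω, 0 ≤ Q z := by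
    intro z hz
    by_cases h : z = (0, 0)
    · rw [h, hQ0]
    · exact (hQpos z hz h).le
  let O := rot e n ⁻¹' Ω
  have hO : IsOpen O := hΩ.preimage rc
  have h0O : ((0, 0) : ℝ × ℝ) ∈ O := by simp only [O, mem_preimage, r0]; exact h0
  have hinj : ∀ z, rot e n z = (0, 0) → z = (0, 0) := by
    intro z hz
    have e1 : z.1 * a + z.2 * -b = 0 := by
      have := congrArg Prod.fst hz; simpa [rot, he, hn] using this
    have e2 : z.1 * b + z.2 * a = 0 := by
      have := congrArg Prod.snd hz; simpa [rot, he, hn] using this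
    apply Prod.ext
    · simp only; linear_combination a * e1 + b * e2 - z.1 * hab
    · simp only; linear_combination a * e2 - b * e1 - z.2 * hab
  have tend : ∀ g : ℝ × ℝ → ℝ, ContDiffOn ℝ (⊤ : ℕ∞) g V →
      Tendsto (fun z => g (rot e n z)) (𝓝 (0, 0)) (𝓝 (g (0, 0))) := by
    intro g hg
    have c : ContinuousAt g (rot e n (0, 0)) := by
      rw [r0]; exact hg.continuousOn.continuousAt (hV.mem_nhds h0V)
    have : Tendsto (g ∘ rot e n) (𝓝 (0, 0)) (𝓝 ((g ∘ rot e n) (0, 0))) :=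
      ContinuousAt.comp c rc.continuousAt
    rw [Function.comp_apply, r0] at this
    exact this
  obtain ⟨ε, hε, ρ, hρ, hlow⟩ := barrier O hO h0O (-dir n (dir n U) (0, 0)) (neg_ne_zero.2 hnn)
    (fun z => Q (rot e n z)) (fun z => dir e Q (rot e n z)) (fun z => dir n Q (rot e n z))
    (fun z => dir e (dir e Q) (rot e n z)) (fun z => dir n (dir n Q) (rot e n z))
    (fun z => dir e U (rot e n z)) (fun z => dir n U (rot e n z))
    (fun z => dir e (dir e U) (rot e n z)) (fun z => dir e (dir n U) (rot e n z))
    (fun z => dir n (dir n U) (rot e n z))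
    (hQ.continuousOn.comp rc.continuousOn (fun z hz => hΩV hz))
    (fun z hz => rot_x hV hQ e n z (hΩV hz)) (fun z hz => rot_x hV (q1 e) e n z (hΩV hz))
    (fun z hz => rot_y hV hQ e n z (hΩV hz)) (fun z hz => rot_y hV (q1 n) e n z (hΩV hz))
    (fun z hz => heq _ hz) (fun z hz => hQge _ hz)
    (fun z hz hne => hQpos _ hz (fun h => hne (hinj z h)))
    (by
      have := rot_o e n (smooth_diff hV (sv e) h0V) he0
      rw [hee, dir_comm hV hU h0V n e, hen] at this
      simpa using this)
    (by
      have := rot_o e n (smooth_diff hV (sv n) h0V) hn0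
      rw [hen] at this
      refine this.congr_left ?_
      intro z; ring)
    (by have := tend _ (svw e e); rwa [hee] at this)
    (by have := tend _ (svw e n); rwa [hen] at this)
    (by have := tend _ (svw n n); rwa [neg_neg])
  have q2 := dir_smooth hV (q1 n) n
  have q3 := dir_smooth hV q2 n
  have q4 := dir_smooth hV q3 n
  have t4 := (tend _ q4).norm.eventually (gt_mem_nhds (lt_add_one ‖dir n (dir n (dir n (dir n Q))) (0, 0)‖))
  have hev : ∀ᶠ z in 𝓝 ((0, 0) : ℝ × ℝ), z ∈ O ∧ ‖dir n (dir n (dir n (dir n Q))) (rot e n z)‖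
      < ‖dir n (dir n (dir n (dir n Q))) (0, 0)‖ + 1 := by
    filter_upwards [hO.mem_nhds h0O, t4] with z a b using ⟨a, b⟩
  obtain ⟨r, hr, hb⟩ := Metric.eventually_nhds_iff_ball.1 hev
  have hin : ∀ t : ℝ, |t| < min ρ r → ((0, t) : ℝ × ℝ) ∈ ball ((0, 0) : ℝ × ℝ) r := by
    intro t ht
    rw [mem_ball, Prod.dist_eq]
    simp only [Real.dist_eq, sub_zero, abs_zero]
    exact max_lt hr (ht.trans_le (min_le_right _ _))
  have hΩt : ∀ t : ℝ, |t| < min ρ r → rot e n (0, t) ∈ Ω := fun t ht => (hb _ (hin t ht)).1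
  have sl : ∀ g : ℝ × ℝ → ℝ, ContDiffOn ℝ (⊤ : ℕ∞) g V → ∀ t : ℝ, |t| < min ρ r →
      HasDerivAt (fun s => g (rot e n (0, s))) (dir n g (rot e n (0, t))) t :=
    fun g hg t ht => rot_y hV hg e n (0, t) (hΩV (hΩt t ht))
  exact oneD (lt_min hρ hr) (by positivity) hε (sl _ hQ) (sl _ (q1 n)) (sl _ q2) (sl _ q3)
    (fun t ht => (hb _ (hin t ht)).2.le) (by rw [r0]; exact hQ0) (by rw [r0]; exact hQn)
    (by rw [r0]; exact hQnn) (fun t ht => hQge _ (hΩt t ht))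
    (fun t h1 h2 => hlow t h1 (h2.trans_le (min_le_left _ _)))


lemma conv_x {V : Set (ℝ × ℝ)} (hV : IsOpen V) {g : ℝ → ℝ → ℝ} {G : ℝ × ℝ → ℝ}
    (hG : ContDiffOn ℝ (⊤ : ℕ∞) G V) (h : ∀ z ∈ V, g z.1 z.2 = G z) :
    ∀ z ∈ V, pdx g z.1 z.2 = dir (1, 0) G z := by
  intro z hz
  have h1 := (slice_x hV hG hz).deriv
  rw [← h1, pdx]
  apply Filter.EventuallyEq.deriv_eq
  have hc : Continuous (fun s : ℝ => ((s, z.2) : ℝ × ℝ)) := by fun_prop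
  filter_upwards [(hV.preimage hc).mem_nhds (show z.1 ∈ _ from hz)] with s hs
  exact h (s, z.2) hs

lemma conv_y {V : Set (ℝ × ℝ)} (hV : IsOpen V) {g : ℝ → ℝ → ℝ} {G : ℝ × ℝ → ℝ}
    (hG : ContDiffOn ℝ (⊤ : ℕ∞) G V) (h : ∀ z ∈ V, g z.1 z.2 = G z) :
    ∀ z ∈ V, pdy g z.1 z.2 = dir (0, 1) G z := by
  intro z hz
  have h1 := (slice_y hV hG hz).deriv
  rw [← h1, pdy]
  apply Filter.EventuallyEq.deriv_eq
  have hc : Continuous (fun s : ℝ => ((z.1, s) : ℝ × ℝ)) := by fun_prop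
  filter_upwards [(hV.preimage hc).mem_nhds (show z.2 ∈ _ from hz)] with s hs
  exact h (z.1, s) hs

lemma exists_prim (f : ℝ → ℝ) (hf : ContDiff ℝ (⊤ : ℕ∞) f) :
    ∃ F : ℝ → ℝ, (∀ t, HasDerivAt F (f t) t) ∧ ContDiff ℝ (⊤ : ℕ∞) F := by
  have h : ∀ t, HasDerivAt (fun t => ∫ s in (0 : ℝ)..t, f s) (f t) t := fun t =>
    (hf.continuous.integral_hasStrictDerivAt 0 t).hasDerivAt
  refine ⟨_, h, ?_⟩
  apply contDiff_infty_iff_deriv.2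
  refine ⟨fun t => (h t).differentiableAt, ?_⟩
  have : deriv (fun t => ∫ s in (0 : ℝ)..t, f s) = f := funext fun t => (h t).deriv
  rw [this]; exact hf

/-- A unit vector in the kernel of a degenerate symmetric matrix. -/
lemma exists_kernel (p q r : ℝ) (h : p * r - q ^ 2 = 0) :
    ∃ a b : ℝ, a ^ 2 + b ^ 2 = 1 ∧ p * a + q * b = 0 ∧ q * a + r * b = 0 := by
  by_cases hp : p = 0
  · have hq : q = 0 := by
      rw [hp] at h; nlinarith
    exact ⟨1, 0, by norm_num, by simp [hp], by simp [hq]⟩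
  · have hpos : 0 < p ^ 2 + q ^ 2 := by positivity
    have hs : 0 < Real.sqrt (p ^ 2 + q ^ 2) := Real.sqrt_pos.2 hpos
    have hs2 : Real.sqrt (p ^ 2 + q ^ 2) ^ 2 = p ^ 2 + q ^ 2 := Real.sq_sqrt hpos.le
    set s := Real.sqrt (p ^ 2 + q ^ 2)
    refine ⟨-q / s, p / s, ?_, ?_, ?_⟩
    · field_simp; linarith
    · field_simp; ring
    · field_simp; linarith

/-- The theorem in terms of directional derivatives. -/
lemma main_dir (Ω : Set (ℝ × ℝ)) (hopen : IsOpen Ω)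
    (hbdd : Bornology.IsBounded Ω) (h0 : ((0, 0) : ℝ × ℝ) ∈ Ω)
    (U : ℝ × ℝ → ℝ) (f : ℝ → ℝ)
    (V : Set (ℝ × ℝ)) (hV : IsOpen V) (hΩV : closure Ω ⊆ V)
    (hu : ContDiffOn ℝ (⊤ : ℕ∞) U V) (hf : ContDiff ℝ (⊤ : ℕ∞) f)
    (hpde : ∀ p ∈ Ω, dir (1, 0) (dir (1, 0) U) p + dir (0, 1) (dir (0, 1) U) p = - f (U p))
    (hpos : ∀ p ∈ Ω, 0 < U p)
    (hbc : ∀ p ∈ frontier Ω, U p = 0)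
    (hcurv : ∀ p ∈ frontier Ω, dir (1, 0) (dir (1, 0) U) p * dir (0, 1) U p ^ 2
      - 2 * dir (1, 0) (dir (0, 1) U) p * dir (1, 0) U p * dir (0, 1) U p
      + dir (0, 1) (dir (0, 1) U) p * dir (1, 0) U p ^ 2 < 0)
    (hx0 : dir (1, 0) U (0, 0) = 0) (hy0 : dir (0, 1) U (0, 0) = 0)
    (huniq : ∀ p ∈ Ω, dir (1, 0) U p = 0 → dir (0, 1) U p = 0 → p = ((0, 0) : ℝ × ℝ)) :
    dir (1, 0) (dir (1, 0) U) (0, 0) * dir (0, 1) (dir (0, 1) U) (0, 0)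
      - dir (1, 0) (dir (0, 1) U) (0, 0) ^ 2 ≠ 0 := by
  intro hdet
  have hsub : Ω ⊆ V := subset_closure.trans hΩV
  have h0V := hsub h0
  obtain ⟨F, hF, hFs⟩ := exists_prim f hf
  have sv := fun v => dir_smooth hV hu v
  have svw := fun v w => dir_smooth hV (sv w) v
  have hQ : ∃ Q : ℝ × ℝ → ℝ, ∀ z, Q z = F (U (0, 0)) -
      ((dir (1, 0) U z ^ 2 + dir (0, 1) U z ^ 2) / 2 + F (U z)) := ⟨_, fun _ => rfl⟩
  obtain ⟨Q, hQ⟩ := hQ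
  have hQs : ContDiffOn ℝ (⊤ : ℕ∞) Q V := by
    have : ContDiffOn ℝ (⊤ : ℕ∞) (fun z => F (U (0, 0)) -
      ((dir (1, 0) U z ^ 2 + dir (0, 1) U z ^ 2) / 2 + F (U z))) V :=
      contDiffOn_const.sub (((((sv (1, 0)).pow 2).add ((sv (0, 1)).pow 2)).div_const 2).add
        (hFs.comp_contDiffOn hu))
    exact this.congr (fun z _ => hQ z)
  have hQ0 : Q (0, 0) = 0 := by rw [hQ, hx0, hy0]; ring
  have fr := frame hV hopen hsub hu f F hF (F (U (0, 0))) (1, 0) (0, 1) (fun z _ => hQ z) hpde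
  have c1 := fun v => (sv v).continuousOn.mono hΩV
  have c2 := fun v w => (svw v w).continuousOn.mono hΩV
  have cq := fun v => (dir_smooth hV hQs v).continuousOn.mono hΩV
  have gx : EqOn (dir (1, 0) Q) (fun z => dir (1, 0) U z * dir (0, 1) (dir (0, 1) U) z
      - dir (0, 1) U z * dir (1, 0) (dir (0, 1) U) z) (closure Ω) :=
    Set.EqOn.of_subset_closure (fun z hz => (fr z hz).1) (cq _)
      (((c1 _).mul (c2 _ _)).sub ((c1 _).mul (c2 _ _))) subset_closure le_rfl
  have gy : EqOn (dir (0, 1) Q) (fun z => dir (0, 1) U z * dir (1, 0) (dir (1, 0) U) z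
      - dir (1, 0) U z * dir (1, 0) (dir (0, 1) U) z) (closure Ω) :=
    Set.EqOn.of_subset_closure (fun z hz => (fr z hz).2.1) (cq _)
      (((c1 _).mul (c2 _ _)).sub ((c1 _).mul (c2 _ _))) subset_closure le_rfl
  have hbd : ∀ p ∈ frontier Ω, ∃ d, 0 < dir d U p ∧ dir d Q p < 0 := by
    intro p hp
    have hc := hcurv p hp
    refine ⟨(dir (1, 0) U p, dir (0, 1) U p), ?_, ?_⟩
    · rw [dir_lin]
      by_contra hcon
      have e1 : dir (1, 0) U p = 0 := by nlinarith [sq_nonneg (dir (1, 0) U p), sq_nonneg (dir (0, 1) U p)]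
      have e2 : dir (0, 1) U p = 0 := by nlinarith [sq_nonneg (dir (1, 0) U p), sq_nonneg (dir (0, 1) U p)]
      rw [e1, e2] at hc
      norm_num at hc
    · rw [dir_lin, gx (frontier_subset_closure hp), gy (frontier_subset_closure hp)]
      simp only
      nlinarith
  have k1 := fun v => (sv v).continuousOn.mono hsub
  have k2 := fun v w => (svw v w).continuousOn.mono hsub
  have hmin := global_min hV hopen hΩV hbdd h0 hu hQs hpos hbc hbd
    (fun z => dir (1, 0) U z ^ 2 + dir (0, 1) U z ^ 2)
    (fun z => 2 * (dir (1, 0) U z * dir (1, 0) (dir (1, 0) U) z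
      + dir (0, 1) U z * dir (1, 0) (dir (0, 1) U) z))
    (fun z => 2 * (dir (1, 0) U z * dir (1, 0) (dir (0, 1) U) z
      + dir (0, 1) U z * dir (0, 1) (dir (0, 1) U) z))
    (((k1 _).pow 2).add ((k1 _).pow 2))
    (continuousOn_const.mul (((k1 _).mul (k2 _ _)).add ((k1 _).mul (k2 _ _))))
    (continuousOn_const.mul (((k1 _).mul (k2 _ _)).add ((k1 _).mul (k2 _ _))))
    (fun z hz => (fr z hz).2.2.1) (fun z _ => by positivity)
    (fun z hz hA => huniq z hz
      (by nlinarith [sq_nonneg (dir (1, 0) U z), sq_nonneg (dir (0, 1) U z)])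
      (by nlinarith [sq_nonneg (dir (1, 0) U z), sq_nonneg (dir (0, 1) U z)]))
  rw [hQ0] at hmin
  by_cases htr : dir (1, 0) (dir (1, 0) U) (0, 0) + dir (0, 1) (dir (0, 1) U) (0, 0) = 0
  · refine gron hV hopen hsub h0 hu f F hf hF ?_ ?_ huniq
    · intro z hz
      by_cases hz0 : z = (0, 0)
      · rw [hz0, hx0, hy0]; simp
      · have := hmin z hz hz0
        rw [hQ] at this
        linarith
    · have := hpde _ h0
      linarith
  · obtain ⟨a, b, hab, hk1, hk2⟩ := exists_kernel _ _ _ hdet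
    have nrm : ∀ z, dir (a, b) U z ^ 2 + dir (-b, a) U z ^ 2
        = dir (1, 0) U z ^ 2 + dir (0, 1) U z ^ 2 := by
      intro z
      rw [dir_lin (a, b), dir_lin (-b, a)]
      linear_combination (dir (1, 0) U z ^ 2 + dir (0, 1) U z ^ 2) * hab
    have tr : ∀ z ∈ V, dir (a, b) (dir (a, b) U) z + dir (-b, a) (dir (-b, a) U) z
        = dir (1, 0) (dir (1, 0) U) z + dir (0, 1) (dir (0, 1) U) z := by
      intro z hz
      rw [dir_lin2 hV hu hz (a, b), dir_lin2 hV hu hz (-b, a)]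
      linear_combination (dir (1, 0) (dir (1, 0) U) z + dir (0, 1) (dir (0, 1) U) z) * hab
    have fr2 := frame (Q := Q) hV hopen hsub hu f F hF (F (U (0, 0))) (a, b) (-b, a)
      (fun z _ => by rw [nrm, hQ]) (fun z hz => by rw [tr z (hsub hz)]; exact hpde z hz)
    have e0 : dir (a, b) U (0, 0) = 0 := by rw [dir_lin, hx0, hy0]; ring
    have n0 : dir (-b, a) U (0, 0) = 0 := by rw [dir_lin, hx0, hy0]; ring
    have ee : dir (a, b) (dir (a, b) U) (0, 0) = 0 := by
      rw [dir_lin2 hV hu h0V]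
      linear_combination a * hk1 + b * hk2
    have en : dir (a, b) (dir (-b, a) U) (0, 0) = 0 := by
      rw [dir_lin2 hV hu h0V]
      linear_combination (-b) * hk1 + a * hk2
    have nn : dir (-b, a) (dir (-b, a) U) (0, 0) ≠ 0 := by
      have := tr _ h0V
      rw [ee, zero_add] at this
      rwa [this]
    refine local_contra hV hopen hsub h0 hu hQs a b hab (a, b) (-b, a) rfl rfl hQ0 hmin
      (fun z hz => (fr2 z hz).2.2.1) e0 n0 ee en nn ?_ ?_
    · rw [(fr2 _ h0).2.1, e0, n0]; ring
    · rw [(fr2 _ h0).2.2.2 e0 n0, ee, en]; ring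

/-- if the boundary of `Ω` has strictly positive curvature, `f(0) ≥ 0`
and `(0,0)` is the only critical point of the positive solution `u`, then `(0,0)` is
a nondegenerate critical point. -/
theorem unique_critical_point_nondegenerate
    (Ω : Set (ℝ × ℝ)) (hopen : IsOpen Ω) (hconn : IsConnected Ω)
    (hbdd : Bornology.IsBounded Ω) (h0 : ((0, 0) : ℝ × ℝ) ∈ Ω)
    (u : ℝ → ℝ → ℝ) (f : ℝ → ℝ)
    (V : Set (ℝ × ℝ)) (hV : IsOpen V) (hΩV : closure Ω ⊆ V)
    (hu : ContDiffOn ℝ (⊤ : ℕ∞) (fun p : ℝ × ℝ => u p.1 p.2) V)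
    (hf : ContDiff ℝ (⊤ : ℕ∞) f) (hf0 : 0 ≤ f 0)
    (hpde : ∀ p ∈ Ω, -(pd u 2 0 p.1 p.2 + pd u 0 2 p.1 p.2) = f (u p.1 p.2))
    (hpos : ∀ p ∈ Ω, 0 < u p.1 p.2)
    (hbc : ∀ p ∈ frontier Ω, u p.1 p.2 = 0)
    (hcurv : ∀ p ∈ frontier Ω, curvNum u p.1 p.2 < 0)
    (hcrit0 : pd u 1 0 0 0 = 0 ∧ pd u 0 1 0 0 = 0)
    (huniq : ∀ p ∈ Ω, pd u 1 0 p.1 p.2 = 0 → pd u 0 1 p.1 p.2 = 0 → p = ((0, 0) : ℝ × ℝ)) :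
    pd u 2 0 0 0 * pd u 0 2 0 0 - (pd u 1 1 0 0) ^ 2 ≠ 0 := by
  have g0 : ∀ z ∈ V, u z.1 z.2 = (fun p : ℝ × ℝ => u p.1 p.2) z := fun _ _ => rfl
  set U : ℝ × ℝ → ℝ := fun p => u p.1 p.2 with hUdef
  have sv := fun v => dir_smooth hV hu v
  have p10 : ∀ z ∈ V, pd u 1 0 z.1 z.2 = dir (1, 0) U z := conv_x hV hu g0
  have p01 : ∀ z ∈ V, pd u 0 1 z.1 z.2 = dir (0, 1) U z := conv_y hV hu g0
  have p20 : ∀ z ∈ V, pd u 2 0 z.1 z.2 = dir (1, 0) (dir (1, 0) U) z := conv_x hV (sv _) p10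
  have p11 : ∀ z ∈ V, pd u 1 1 z.1 z.2 = dir (1, 0) (dir (0, 1) U) z := conv_x hV (sv _) p01
  have p02 : ∀ z ∈ V, pd u 0 2 z.1 z.2 = dir (0, 1) (dir (0, 1) U) z := conv_y hV (sv _) p01
  have hsub : Ω ⊆ V := subset_closure.trans hΩV
  have hfr : frontier Ω ⊆ V := frontier_subset_closure.trans hΩV
  have h0V := hsub h0
  have key := main_dir Ω hopen hbdd h0 U f V hV hΩV hu hf
    (fun p hp => by
      have := hpde p hp
      rw [p20 p (hsub hp), p02 p (hsub hp)] at this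
      show _ = - f (u p.1 p.2)
      linarith)
    hpos hbc
    (fun p hp => by
      have := hcurv p hp
      rw [curvNum, p20 p (hfr hp), p02 p (hfr hp), p11 p (hfr hp), p10 p (hfr hp),
        p01 p (hfr hp)] at this
      exact this)
    (by rw [← p10 _ h0V]; exact hcrit0.1) (by rw [← p01 _ h0V]; exact hcrit0.2)
    (fun p hp h1 h2 => huniq p hp (by rw [p10 p (hsub hp)]; exact h1)
      (by rw [p01 p (hsub hp)]; exact h2))
  rw [← p20 _ h0V, ← p02 _ h0V, ← p11 _ h0V] at key
  exact key
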